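/- Let 0 < α < 1, l > 0, T > 0, and let u : [0,l] × [0,T] → ℝ have continuous ∂u/∂t and ∂²u/∂t² on [0,l] × [0,T]. Then for every t ∈ (0,T], ∫_0^l u_t(x,t) ∂_{0t}^{1+α} u(x,t) dx ≥ (1/2) ∂_{0t}^α ( ∫_0^l u_t(x,t)² dx ), where the Caputo derivative on the right acts on the function t ↦ ∫_0^l u_t(x,t)² dx. -/

import Mathlib

open MeasureTheory Set

/-- The Caputo fractional derivative of order `α`, `0 < α < 1`, of `v` at `t`:
`∂_{0t}^α v(t) = (1/Γ(1-α)) ∫_0^t v'(τ) (t-τ)^(-α) dτ`. -/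
noncomputable def caputo (α : ℝ) (v : ℝ → ℝ) (t : ℝ) : ℝ :=
  (1 / Real.Gamma (1 - α)) * ∫ τ in (0:ℝ)..t, deriv v τ * (t - τ) ^ (-α)

/-- The Caputo fractional derivative of order `1 + α`, `0 < α < 1`, of `v` at `t`:
`∂_{0t}^{1+α} v(t) = (1/Γ(1-α)) ∫_0^t v''(τ) (t-τ)^(-α) dτ`. -/
noncomputable def caputoOnePlus (α : ℝ) (v : ℝ → ℝ) (t : ℝ) : ℝ :=
  (1 / Real.Gamma (1 - α)) * ∫ τ in (0:ℝ)..t, deriv (deriv v) τ * (t - τ) ^ (-α)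


theorem ker_int (α t : ℝ) (hα1 : α < 1) :
    IntervalIntegrable (fun τ : ℝ => (t - τ) ^ (-α)) volume 0 t := by
  have h := (intervalIntegral.intervalIntegrable_rpow' (a := 0) (b := t) (r := -α) (by linarith)).comp_sub_left t
  simpa using h.symm

theorem pointwise_ge (α t : ℝ) (hα0 : 0 < α) (hα1 : α < 1) (ht : 0 < t) (w : ℝ → ℝ)
    (hd : ∀ s ∈ Icc (0:ℝ) t, DifferentiableAt ℝ w s)
    (hc : ContinuousOn (deriv w) (Icc 0 t)) :
    0 ≤ ∫ τ in (0:ℝ)..t, (w t - w τ) * deriv w τ * (t - τ) ^ (-α) := by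
  have hwc : ContinuousOn w (Icc 0 t) := fun s hs => (hd s hs).continuousAt.continuousWithinAt
  set F : ℝ → ℝ := fun τ => -(1/2) * (w t - w τ)^2 * (t - τ)^(-α) with hF
  have hFc : ContinuousOn F (Icc 0 t) := by
    have h1 : ContinuousOn (fun τ => -(1/2) * (dslope w t τ)^2 * (t - τ)^(2-α)) (Icc 0 t) := by
      have hds : ContinuousOn (dslope w t) (Icc 0 t) := by
        intro s hs
        by_cases hst : s = t
        · subst hst
          exact (continuousAt_dslope_same.2 (hd _ hs)).continuousWithinAt
        · exact ((continuousAt_dslope_of_ne hst).2 (hd s hs).continuousAt).continuousWithinAt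
      refine (continuousOn_const.mul (hds.pow 2)).mul ?_
      exact (continuousOn_const.sub continuousOn_id).rpow_const (fun s _ => Or.inr (by linarith))
    refine h1.congr ?_
    intro s hs
    by_cases hst : s = t
    · subst hst
      simp [hF]
      right
      exact Real.zero_rpow (by linarith)
    · have hlt : 0 < t - s := by
        have := lt_of_le_of_ne hs.2 hst
        linarith
      simp only [hF]
      rw [dslope_of_ne _ hst, slope_def_field, show (2 - α) = (2:ℕ) + (-α) by push_cast; ring,
        Real.rpow_add hlt, Real.rpow_natCast]
      have : s - t ≠ 0 := by linarith
      field_simp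
      ring
  have hFd : ∀ s ∈ Ioo 0 t, HasDerivAt F ((w t - w s) * deriv w s * (t - s) ^ (-α)
      - α / 2 * (w t - w s)^2 * (t - s)^(-α - 1)) s := by
    intro s hs
    have hlt : 0 < t - s := by linarith [hs.2]
    have hw := (hd s ⟨hs.1.le, hs.2.le⟩).hasDerivAt
    have h1 := ((hw.const_sub (w t)).pow 2).const_mul (-(1/2) : ℝ)
    have h2 : HasDerivAt (fun τ : ℝ => (t - τ)^(-α)) (-1 * (-α) * (t - s)^(-α - 1)) s :=
      ((hasDerivAt_id s).const_sub t).rpow_const (Or.inl hlt.ne')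
    have h3 := h1.mul h2
    refine (h3.congr_deriv ?_)
    simp
    ring
  have key := intervalIntegral.sub_le_integral_of_hasDeriv_right_of_le ht.le hFc
    (fun s hs => (hFd s hs).hasDerivWithinAt)
    (φ := fun τ => (w t - w τ) * deriv w τ * (t - τ) ^ (-α)) ?_ ?_
  · have e1 : F t = 0 := by simp [hF]
    have e2 : F 0 ≤ 0 := by
      simp only [hF]
      have : 0 ≤ (w t - w 0)^2 * (t - 0)^(-α) := mul_nonneg (sq_nonneg _) (Real.rpow_nonneg (by linarith) _)
      nlinarith
    linarith
  · rw [← intervalIntegrable_iff_integrableOn_Icc_of_le ht.le]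
    refine (ker_int α t hα1).continuousOn_mul ?_
    rw [uIcc_of_le ht.le]
    exact (continuousOn_const.sub hwc).mul hc
  · intro s hs
    have : 0 ≤ α / 2 * (w t - w s)^2 * (t - s)^(-α - 1) :=
      mul_nonneg (by positivity) (Real.rpow_nonneg (by linarith [hs.2]) _)
    linarith

theorem prod_int (α l t : ℝ) (hα1 : α < 1) (ht : 0 < t) (H : ℝ × ℝ → ℝ)
    (hH : ContinuousOn H (Icc 0 l ×ˢ Icc 0 t)) :
    Integrable (fun p : ℝ × ℝ => H p * (t - p.2) ^ (-α))
      ((volume.restrict (Ioc 0 l)).prod (volume.restrict (Ioc 0 t))) := by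
  have hk : Integrable (fun τ : ℝ => (t - τ) ^ (-α)) (volume.restrict (Ioc 0 t)) :=
    (intervalIntegrable_iff_integrableOn_Ioc_of_le ht.le).1 (ker_int α t hα1)
  have hk2 : Integrable (fun p : ℝ × ℝ => (t - p.2) ^ (-α))
      ((volume.restrict (Ioc 0 l)).prod (volume.restrict (Ioc 0 t))) := hk.comp_snd _
  obtain ⟨C, hC⟩ := (isCompact_Icc.prod isCompact_Icc).exists_bound_of_continuousOn hH
  have hsub : Ioc 0 l ×ˢ Ioc 0 t ⊆ Icc 0 l ×ˢ Icc 0 t :=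
    prod_mono Ioc_subset_Icc_self Ioc_subset_Icc_self
  refine hk2.bdd_mul (c := C) ?_ ?_
  · rw [Measure.prod_restrict]
    exact (hH.mono hsub).aestronglyMeasurable (measurableSet_Ioc.prod measurableSet_Ioc)
  · rw [Measure.prod_restrict]
    filter_upwards [ae_restrict_mem (measurableSet_Ioc.prod measurableSet_Ioc)] with p hp
    exact hC p (hsub hp)

theorem deriv_energy (l t : ℝ) (hl : 0 < l) (w : ℝ → ℝ → ℝ)
    (hwc : ContinuousOn (fun p : ℝ × ℝ => w p.1 p.2) (Icc 0 l ×ˢ Icc 0 t))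
    (hd : ∀ x ∈ Icc (0:ℝ) l, ∀ s ∈ Icc (0:ℝ) t, DifferentiableAt ℝ (w x) s)
    (hgc : ContinuousOn (fun p : ℝ × ℝ => deriv (w p.1) p.2) (Icc 0 l ×ˢ Icc 0 t))
    (s : ℝ) (hs : s ∈ Ioo 0 t) :
    deriv (fun s => ∫ x in (0:ℝ)..l, (w x s) ^ 2) s
      = ∫ x in (0:ℝ)..l, 2 * (w x s * deriv (w x) s) := by
  have hslice : ∀ (H : ℝ × ℝ → ℝ), ContinuousOn H (Icc 0 l ×ˢ Icc 0 t) → ∀ r ∈ Ioo 0 t,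
      IntervalIntegrable (fun x => H (x, r)) volume 0 l := by
    intro H hH r hr
    apply ContinuousOn.intervalIntegrable
    rw [uIcc_of_le hl.le]
    exact hH.comp (by fun_prop) (fun x hx => ⟨hx, hr.1.le, hr.2.le⟩)
  have hA : ContinuousOn (fun p : ℝ × ℝ => (w p.1 p.2)^2) (Icc 0 l ×ˢ Icc 0 t) := hwc.pow 2
  have hB : ContinuousOn (fun p : ℝ × ℝ => 2 * (w p.1 p.2 * deriv (w p.1) p.2))
      (Icc 0 l ×ˢ Icc 0 t) := continuousOn_const.mul (hwc.mul hgc)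
  obtain ⟨C, hC⟩ := (isCompact_Icc.prod isCompact_Icc).exists_bound_of_continuousOn hB
  have hnhds : Ioo 0 t ∈ nhds s := isOpen_Ioo.mem_nhds hs
  refine (intervalIntegral.hasDerivAt_integral_of_dominated_loc_of_deriv_le
    (F := fun s x => (w x s)^2) (F' := fun s x => 2 * (w x s * deriv (w x) s))
    (bound := fun _ => C) hnhds ?_ (hslice _ hA s hs) ?_ ?_ (by simp) ?_).2.deriv
  · filter_upwards [hnhds] with r hr
    exact (intervalIntegrable_iff.1 (hslice _ hA r hr)).aestronglyMeasurable
  · exact (intervalIntegrable_iff.1 (hslice _ hB s hs)).aestronglyMeasurable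
  · refine Filter.Eventually.of_forall fun x hx r hr => ?_
    rw [uIoc_of_le hl.le] at hx
    exact hC (x, r) ⟨⟨hx.1.le, hx.2⟩, hr.1.le, hr.2.le⟩
  · refine Filter.Eventually.of_forall fun x hx r hr => ?_
    rw [uIoc_of_le hl.le] at hx
    refine ((hd x ⟨hx.1.le, hx.2⟩ r ⟨hr.1.le, hr.2.le⟩).hasDerivAt.pow 2).congr_deriv ?_
    simp
    ring

/-- For `u` with continuous `∂u/∂t` and `∂²u/∂t²` on `[0,l]×[0,T]`, one has
`∫_0^l u_t(x,t) ∂_{0t}^{1+α} u(x,t) dx ≥ (1/2) ∂_{0t}^α (∫_0^l u_t(x,t)² dx)`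
for all `t ∈ (0,T]`. -/
theorem integral_ut_mul_caputoOnePlus_ge
    (α l T : ℝ) (hα0 : 0 < α) (hα1 : α < 1) (hl : 0 < l) (hT : 0 < T)
    (u : ℝ → ℝ → ℝ)
    (hut_diff : ∀ x ∈ Set.Icc (0:ℝ) l, ∀ t ∈ Set.Icc (0:ℝ) T, DifferentiableAt ℝ (u x) t)
    (hut_cont : ContinuousOn (fun p : ℝ × ℝ => deriv (u p.1) p.2)
      (Set.Icc 0 l ×ˢ Set.Icc 0 T))
    (hutt_diff : ∀ x ∈ Set.Icc (0:ℝ) l, ∀ t ∈ Set.Icc (0:ℝ) T,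
      DifferentiableAt ℝ (deriv (u x)) t)
    (hutt_cont : ContinuousOn (fun p : ℝ × ℝ => deriv (deriv (u p.1)) p.2)
      (Set.Icc 0 l ×ˢ Set.Icc 0 T)) :
    ∀ t ∈ Set.Ioc (0:ℝ) T,
      (∫ x in (0:ℝ)..l, deriv (u x) t * caputoOnePlus α (u x) t)
        ≥ (1 / 2) * caputo α (fun s => ∫ x in (0:ℝ)..l, (deriv (u x) s) ^ 2) t := by
  intro t ht
  have ht0 : 0 < t := ht.1
  have hsubI : Icc 0 t ⊆ Icc 0 T := Icc_subset_Icc_right ht.2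
  have hsub : Icc 0 l ×ˢ Icc 0 t ⊆ Icc 0 l ×ˢ Icc 0 T := prod_mono le_rfl hsubI
  have hwc := hut_cont.mono hsub
  have hgc := hutt_cont.mono hsub
  have hwt : ContinuousOn (fun p : ℝ × ℝ => deriv (u p.1) t) (Icc 0 l ×ˢ Icc 0 t) :=
    hwc.comp (f := fun p : ℝ × ℝ => (p.1, t)) (by fun_prop)
      (fun p hp => ⟨hp.1, ht0.le, le_rfl⟩)
  have hI1 := prod_int α l t hα1 ht0 _ (hwt.mul hgc)
  have hI2 := prod_int α l t hα1 ht0 _ (hwc.mul hgc)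
  have hG : 0 < 1 / Real.Gamma (1 - α) := one_div_pos.2 (Real.Gamma_pos_of_pos (by linarith))
  have hL : (∫ x in (0:ℝ)..l, deriv (u x) t * caputoOnePlus α (u x) t)
      = (1 / Real.Gamma (1 - α)) * ∫ x in Ioc 0 l, ∫ τ in Ioc 0 t,
        deriv (u x) t * deriv (deriv (u x)) τ * (t - τ) ^ (-α) := by
    rw [intervalIntegral.integral_of_le hl.le, ← integral_const_mul]
    refine integral_congr_ae (Filter.Eventually.of_forall fun x => ?_)
    simp only [caputoOnePlus, mul_assoc]
    rw [intervalIntegral.integral_of_le ht0.le, integral_const_mul]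
    ring
  have hR : (1 / 2) * caputo α (fun s => ∫ x in (0:ℝ)..l, (deriv (u x) s) ^ 2) t
      = (1 / Real.Gamma (1 - α)) * ∫ x in Ioc 0 l, ∫ τ in Ioc 0 t,
        deriv (u x) τ * deriv (deriv (u x)) τ * (t - τ) ^ (-α) := by
    rw [integral_integral_swap hI2, caputo, intervalIntegral.integral_of_le ht0.le,
      mul_left_comm, ← integral_const_mul]
    congr 1
    rw [integral_Ioc_eq_integral_Ioo, integral_Ioc_eq_integral_Ioo]
    refine setIntegral_congr_fun measurableSet_Ioo fun τ hτ => ?_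
    rw [deriv_energy l t hl (fun x => deriv (u x)) hwc
      (fun x hx s hs => hutt_diff x hx s (hsubI hs)) hgc τ hτ,
      intervalIntegral.integral_of_le hl.le, integral_const_mul, integral_mul_const]
    ring
  rw [hL, hR, ge_iff_le]
  refine mul_le_mul_of_nonneg_left ?_ hG.le
  refine integral_mono_ae hI2.integral_prod_left hI1.integral_prod_left ?_
  filter_upwards [ae_restrict_mem measurableSet_Ioc, hI1.prod_right_ae, hI2.prod_right_ae]
    with x hx h1 h2
  have hx' : x ∈ Icc 0 l := ⟨hx.1.le, hx.2⟩
  have hpw := pointwise_ge α t hα0 hα1 ht0 (deriv (u x))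
    (fun s hs => hutt_diff x hx' s (hsubI hs))
    (hgc.comp (f := fun s => (x, s)) (by fun_prop) (fun s hs => ⟨hx', hs⟩))
  rw [intervalIntegral.integral_of_le ht0.le] at hpw
  rw [← sub_nonneg]
  simp only [Pi.mul_apply] at h1 h2
  rw [← integral_sub h1 h2]
  refine hpw.trans_eq (integral_congr_ae (Filter.Eventually.of_forall fun τ => ?_))
  simp only
  ring
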